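/- Residue summation identity for elliptic functions: for pairwise distinct u₁,...,uₙ, v₁,...,vₙ, with t = ∑ₗ(uₗ-vₗ)+γ and ε ∈ {0, +1, -1}, one has ∑_{b=1}^{n} (∏ₗ[u_b - v_l]/∏_{l≠b}[u_b - u_l]) · ([v_j - u_b + t]/[v_j - u_b]) · ([u_b - v_k + γ + ε]/[u_b - v_k + ε]) = δ_{j,k} δ_{ε,0} [γ][t] ∏_{l≠j}[v_j - v_l]/∏ₗ[v_j - u_l] − (1−δ_{ε,0})[γ] ∏ₗ([v_k − ε − v_l]/[v_k − ε − u_l]) · [v_j − v_k + ε + t]/[v_j − v_k + ε]. -/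

import Mathlib

open Complex Real BigOperators

/-- The Jacobi theta function `θ₁(z;τ)`. -/
noncomputable def jacobiTheta₁ (z τ : ℂ) : ℂ :=
  -Complex.I * ∑' k : ℤ, (-1 : ℂ) ^ k *
    Complex.exp ((π : ℂ) * Complex.I * τ * ((k : ℂ) + 1 / 2) ^ 2) *
    Complex.exp (2 * (π : ℂ) * Complex.I * ((k : ℂ) + 1 / 2) * z)

/-- The derivative of `θ₁` with respect to `z`. -/
noncomputable def jacobiTheta₁' (z τ : ℂ) : ℂ :=
  deriv (fun w => jacobiTheta₁ w τ) z

/-- The equivalence splitting pairs of integers according to the parity of their sum. -/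
def intPairParityEquiv : (ℤ × ℤ) ⊕ (ℤ × ℤ) ≃ ℤ × ℤ where
  toFun := Sum.elim (fun p => (p.1 + p.2, p.1 - p.2)) (fun p => (p.1 + p.2 + 1, p.1 - p.2))
  invFun p := if (p.1 + p.2) % 2 = 0 then .inl ((p.1 + p.2) / 2, (p.1 - p.2) / 2)
    else .inr ((p.1 + p.2 - 1) / 2, (p.1 - p.2 - 1) / 2)
  left_inv := by
    rintro (⟨a, b⟩ | ⟨a, b⟩)
    · refine (if_pos (show (a + b + (a - b)) % 2 = 0 by omega)).trans ?_
      simp only [Sum.elim_inl, Sum.inl.injEq, Prod.mk.injEq]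
      omega
    · refine (if_neg (show ¬ (a + b + 1 + (a - b)) % 2 = 0 by omega)).trans ?_
      simp only [Sum.elim_inr, Sum.inr.injEq, Prod.mk.injEq]
      omega
  right_inv := by
    rintro ⟨k, m⟩
    dsimp only
    split_ifs with h
    · simp only [Sum.elim_inl, Prod.mk.injEq]
      omega
    · simp only [Sum.elim_inr, Prod.mk.injEq]
      omega

lemma HasSum.mul_prod_complex {ι κ : Type*} {f : ι → ℂ} {g : κ → ℂ} {a b : ℂ} (hf : HasSum f a)
    (hg : HasSum g b) : HasSum (fun p : ι × κ => f p.1 * g p.2) (a * b) :=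
  HasSum.mul hf hg (summable_mul_of_summable_norm hf.summable.norm hg.summable.norm)

lemma hasSum_jacobiTheta₂_term_mul (z w : ℂ) {τ : ℂ} (hτ : 0 < τ.im) :
    HasSum (fun p : ℤ × ℤ => jacobiTheta₂_term p.1 z τ * jacobiTheta₂_term p.2 w τ)
      (jacobiTheta₂ z τ * jacobiTheta₂ w τ) := by
  have hz := hasSum_jacobiTheta₂_term z hτ
  have hw := hasSum_jacobiTheta₂_term w hτ
  have hzw := hz.mul_prod_complex hw
  exact hzw

/-- The addition formula expressing a product of theta functions in terms of the period `2τ`. -/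
lemma jacobiTheta₂_mul_jacobiTheta₂ (z w : ℂ) {τ : ℂ} (hτ : 0 < τ.im) :
    jacobiTheta₂ z τ * jacobiTheta₂ w τ =
      jacobiTheta₂ (z + w) (2 * τ) * jacobiTheta₂ (z - w) (2 * τ) +
      cexp (π * I * τ + 2 * π * I * z) *
        (jacobiTheta₂ (z + w + τ) (2 * τ) * jacobiTheta₂ (z - w + τ) (2 * τ)) := by
  have hτ2 : 0 < (2 * τ).im := by simpa using hτ
  have h1 := intPairParityEquiv.hasSum_iff.2 (hasSum_jacobiTheta₂_term_mul z w hτ)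
  refine h1.unique (HasSum.sum ?_ ?_)
  · refine (hasSum_jacobiTheta₂_term_mul (z + w) (z - w) hτ2).congr_fun fun p => ?_
    simp only [Function.comp_apply, intPairParityEquiv, Equiv.coe_fn_mk, Sum.elim_inl,
      jacobiTheta₂_term, ← Complex.exp_add]
    push_cast
    ring_nf
  · refine ((hasSum_jacobiTheta₂_term_mul (z + w + τ) (z - w + τ) hτ2).mul_left _).congr_fun
      fun p => ?_
    simp only [Function.comp_apply, intPairParityEquiv, Equiv.coe_fn_mk, Sum.elim_inr,
      jacobiTheta₂_term, ← Complex.exp_add]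
    push_cast
    ring_nf

lemma jacobiTheta₁_eq_jacobiTheta₂ (z τ : ℂ) :
    jacobiTheta₁ z τ = -I * (cexp (π * I * τ / 4 + π * I * z) *
      jacobiTheta₂ (z + τ / 2 + 1 / 2) τ) := by
  rw [jacobiTheta₁, jacobiTheta₂, ← tsum_mul_left (a := cexp _)]
  refine congrArg (-I * ·) (tsum_congr fun k => ?_)
  have : (-1 : ℂ) ^ k = cexp (k * (π * I)) := by rw [Complex.exp_int_mul, Complex.exp_pi_mul_I]
  rw [this, jacobiTheta₂_term, ← Complex.exp_add, ← Complex.exp_add, ← Complex.exp_add]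
  ring_nf

lemma differentiable_jacobiTheta₁ {τ : ℂ} (hτ : 0 < τ.im) :
    Differentiable ℂ fun z => jacobiTheta₁ z τ := by
  simp only [jacobiTheta₁_eq_jacobiTheta₂]
  have h : Differentiable ℂ fun z => jacobiTheta₂ z τ :=
    fun z => differentiableAt_jacobiTheta₂_fst z hτ
  have h' : Differentiable ℂ fun z => jacobiTheta₂ (z + τ / 2 + 1 / 2) τ :=
    h.comp (by fun_prop : Differentiable ℂ fun z : ℂ => z + τ / 2 + 1 / 2)
  fun_prop

/-- A product of shifted `θ₁` is a determinant in two theta functions of period `2τ`. -/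
lemma jacobiTheta₁_add_mul_jacobiTheta₁_sub (x y : ℂ) {τ : ℂ} (hτ : 0 < τ.im) :
    jacobiTheta₁ (x + y) τ * jacobiTheta₁ (x - y) τ =
      jacobiTheta₂ (2 * x) (2 * τ) *
        (cexp (π * I * τ / 2 + 2 * π * I * y) * jacobiTheta₂ (2 * y + τ) (2 * τ)) -
      cexp (π * I * τ / 2 + 2 * π * I * x) * jacobiTheta₂ (2 * x + τ) (2 * τ) *
        jacobiTheta₂ (2 * y) (2 * τ) := by
  have h := jacobiTheta₂_mul_jacobiTheta₂ (x + y + τ / 2 + 1 / 2) (x - y + τ / 2 + 1 / 2) hτ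
  rw [show x + y + τ / 2 + 1 / 2 + (x - y + τ / 2 + 1 / 2) + τ = 2 * x + 2 * τ + 1 by ring,
    show x + y + τ / 2 + 1 / 2 + (x - y + τ / 2 + 1 / 2) = 2 * x + τ + 1 by ring,
    show x + y + τ / 2 + 1 / 2 - (x - y + τ / 2 + 1 / 2) = 2 * y by ring,
    jacobiTheta₂_add_left, jacobiTheta₂_add_left, jacobiTheta₂_add_left'] at h
  have e1 : cexp (π * I * τ / 4 + π * I * (x + y)) * cexp (π * I * τ / 4 + π * I * (x - y)) =
      cexp (π * I * τ / 2 + 2 * π * I * x) := by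
    rw [← Complex.exp_add]; ring_nf
  have e2 : cexp (π * I * τ / 2 + 2 * π * I * x) *
      (cexp (π * I * τ + 2 * π * I * (x + y + τ / 2 + 1 / 2)) *
        cexp (-π * I * (2 * τ + 2 * (2 * x)))) = -cexp (π * I * τ / 2 + 2 * π * I * y) := by
    rw [← Complex.exp_add, ← Complex.exp_add, ← Complex.exp_add_pi_mul_I]
    ring_nf
  rw [jacobiTheta₁_eq_jacobiTheta₂, jacobiTheta₁_eq_jacobiTheta₂]
  linear_combination I ^ 2 * cexp (π * I * τ / 4 + π * I * (x + y)) *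
      cexp (π * I * τ / 4 + π * I * (x - y)) * h + (I ^ 2 *
      (jacobiTheta₂ (2 * x + τ) (2 * τ) * jacobiTheta₂ (2 * y) (2 * τ) +
        cexp (π * I * τ + 2 * π * I * (x + y + τ / 2 + 1 / 2)) *
        (cexp (-π * I * (2 * τ + 2 * (2 * x))) * jacobiTheta₂ (2 * x) (2 * τ) *
          jacobiTheta₂ (2 * y + τ) (2 * τ)))) * e1 +
      I ^ 2 * jacobiTheta₂ (2 * x) (2 * τ) * jacobiTheta₂ (2 * y + τ) (2 * τ) * e2 +
      (jacobiTheta₂ (2 * x + τ) (2 * τ) * jacobiTheta₂ (2 * y) (2 * τ) *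
        cexp (π * I * τ / 2 + 2 * π * I * x) - jacobiTheta₂ (2 * x) (2 * τ) *
        jacobiTheta₂ (2 * y + τ) (2 * τ) * cexp (π * I * τ / 2 + 2 * π * I * y)) * Complex.I_sq

section ThetaRelations

/-- A function whose shifted products are `2 × 2` determinants is odd. -/
lemma odd_of_mul_eq_det {f A B : ℂ → ℂ}
    (h : ∀ x y, f (x + y) * f (x - y) = A x * B y - B x * A y) (z : ℂ) : f (-z) = -f z := by
  by_cases hf : ∃ a, f a ≠ 0
  · obtain ⟨a, ha⟩ := hf
    have h1 := h ((a + z) / 2) ((a - z) / 2)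
    have h2 := h ((a - z) / 2) ((a + z) / 2)
    rw [show (a + z) / 2 + (a - z) / 2 = a by ring,
      show (a + z) / 2 - (a - z) / 2 = z by ring] at h1
    rw [show (a - z) / 2 + (a + z) / 2 = a by ring,
      show (a - z) / 2 - (a + z) / 2 = -z by ring] at h2
    apply mul_left_cancel₀ ha
    linear_combination h1 + h2
  · push Not at hf
    simp [hf]

/-- The three-term relation, written for products of two factors with equal sum of zeros. -/
lemma three_term_of_mul_eq_det {f A B : ℂ → ℂ}
    (h : ∀ x y, f (x + y) * f (x - y) = A x * B y - B x * A y) (z p q a b : ℂ) :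
    f (z - p) * f (z - q) * (f (a + b - (p + q)) * f (a - b)) =
      f (z - a) * f (z - (p + q - a)) * (f (p - b) * f (q - b)) * (-1) +
      f (z - b) * f (z - (p + q - b)) * (f (p - a) * f (q - a)) := by
  have key : ∀ z u w : ℂ, f (z - u) * f (z - w) =
      A (z - (u + w) / 2) * B (u - (u + w) / 2) - B (z - (u + w) / 2) * A (u - (u + w) / 2) := by
    intro z u w
    rw [← h]
    ring_nf
  have odd := odd_of_mul_eq_det h
  have h1 := key z p q
  have h2 := key z a (p + q - a)
  have h3 := key z b (p + q - b)
  have h4 := h (a - (p + q) / 2) (b - (p + q) / 2)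
  have h5 := key b p q
  have h6 := key a p q
  rw [show a + (p + q - a) = p + q by ring] at h2
  rw [show b + (p + q - b) = p + q by ring] at h3
  rw [show a - (p + q) / 2 + (b - (p + q) / 2) = a + b - (p + q) by ring,
    show a - (p + q) / 2 - (b - (p + q) / 2) = a - b by ring] at h4
  have e1 : f (p - b) * f (q - b) = f (b - p) * f (b - q) := by
    rw [← neg_sub b p, ← neg_sub b q, odd, odd]; ring
  have e2 : f (p - a) * f (q - a) = f (a - p) * f (a - q) := by
    rw [← neg_sub a p, ← neg_sub a q, odd, odd]; ring
  rw [e1, e2, h1, h2, h3, h4, h5, h6]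
  ring

variable {ι : Type*} [DecidableEq ι]

/-- A pole cancelled by a zero drops out of the residue sum. -/
lemma sum_div_prod_erase_of_cancel {f : ℂ → ℂ} (f0 : f 0 = 0) (s : Finset ι) (x : ι → ℂ)
    (hx : ∀ i ∈ s, ∀ l ∈ s, i ≠ l → f (x i - x l) ≠ 0) {a : ι} (ha : a ∈ s) (g : ℂ → ℂ) :
    ∑ i ∈ s, f (x i - x a) * g (x i) / ∏ l ∈ s.erase i, f (x i - x l) =
      ∑ i ∈ s.erase a, g (x i) / ∏ l ∈ (s.erase a).erase i, f (x i - x l) := by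
  rw [← Finset.add_sum_erase s _ ha]
  simp only [sub_self, f0, zero_mul, zero_div, zero_add]
  refine Finset.sum_congr rfl fun i hi => ?_
  obtain ⟨hia, his⟩ := Finset.mem_erase.1 hi
  have hmem : a ∈ s.erase i := Finset.mem_erase.2 ⟨hia.symm, ha⟩
  rw [← Finset.mul_prod_erase (s.erase i) _ hmem, Finset.erase_right_comm,
    mul_div_mul_left _ _ (hx i his a ha hia)]

/-- Vanishing of the sum of the residues of `∏ f (z - y l) / ∏ f (z - x l)` when the zeros and the
poles have the same sum. -/
theorem sum_prod_div_prod_erase_eq_zero {f A B : ℂ → ℂ} (hd : Differentiable ℂ f)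
    (h : ∀ x y, f (x + y) * f (x - y) = A x * B y - B x * A y) (s : Finset ι) (x y : ι → ℂ)
    (hx : ∀ i ∈ s, ∀ l ∈ s, i ≠ l → f (x i - x l) ≠ 0) (hxy : ∑ i ∈ s, x i = ∑ i ∈ s, y i) :
    ∑ i ∈ s, (∏ l ∈ s, f (x i - y l)) / ∏ l ∈ s.erase i, f (x i - x l) = 0 := by
  have odd := odd_of_mul_eq_det h
  have f0 : f 0 = 0 := by
    have := odd 0
    rw [neg_zero] at this
    linear_combination this / 2
  induction hn : s.card generalizing s y with
  | zero => simp [Finset.card_eq_zero.1 hn]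
  | succ m ih =>
    rcases Nat.lt_or_ge m 1 with hm | hm
    · obtain ⟨a, rfl⟩ := Finset.card_eq_one.1 (by omega : s.card = 1)
      simp only [Finset.sum_singleton] at hxy
      simp [hxy, f0]
    obtain ⟨a, ha, b, hb, hab⟩ := Finset.one_lt_card.1 (by omega : 1 < s.card)
    have hab' : f (x a - x b) ≠ 0 := hx a ha b hb hab
    have hbe : b ∈ s.erase a := Finset.mem_erase.2 ⟨hab.symm, hb⟩
    have generic : ∀ y : ι → ℂ, ∑ i ∈ s, x i = ∑ i ∈ s, y i →
        f (x a + x b - (y a + y b)) ≠ 0 →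
        ∑ i ∈ s, (∏ l ∈ s, f (x i - y l)) / ∏ l ∈ s.erase i, f (x i - x l) = 0 := by
      intro y hxy hD
      have remove : ∀ c ∈ s, ∀ d ∈ s, c ≠ d → y c + y d = y a + y b →
          (s.erase c).erase d = (s.erase a).erase b →
          ∑ i ∈ s, f (x i - x c) * (f (x i - (y a + y b - x c)) *
            ∏ l ∈ (s.erase a).erase b, f (x i - y l)) / ∏ l ∈ s.erase i, f (x i - x l) = 0 := by
        intro c hc d hd hcd hy he
        have hde : d ∈ s.erase c := Finset.mem_erase.2 ⟨hcd.symm, hd⟩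
        rw [sum_div_prod_erase_of_cancel f0 s x hx hc (fun z => f (z - (y a + y b - x c)) *
            ∏ l ∈ (s.erase a).erase b, f (z - y l))]
        rw [← ih (s.erase c) (Function.update y d (y a + y b - x c))
          (fun i hi l hl => hx i (Finset.mem_of_mem_erase hi) l (Finset.mem_of_mem_erase hl)) ?_
          (by rw [Finset.card_erase_of_mem hc, hn]; rfl)]
        · refine Finset.sum_congr rfl fun i _ => ?_
          rw [← Finset.mul_prod_erase (s.erase c) _ hde, Function.update_self, he]
          congr 2
          refine Finset.prod_congr rfl fun l hl => ?_
          rw [Function.update_of_ne]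
          rw [← he] at hl
          exact Finset.ne_of_mem_erase hl
        · rw [← Finset.add_sum_erase (s.erase c) (Function.update y d _) hde, Function.update_self]
          have : ∑ l ∈ (s.erase c).erase d, Function.update y d (y a + y b - x c) l =
              ∑ l ∈ (s.erase c).erase d, y l :=
            Finset.sum_congr rfl fun l hl => Function.update_of_ne (Finset.ne_of_mem_erase hl) _ _
          rw [this]
          rw [← Finset.add_sum_erase s x hc, ← Finset.add_sum_erase s y hc,
            ← Finset.add_sum_erase (s.erase c) y hde] at hxy
          linear_combination hxy + hy
      have ra := remove a ha b hb hab rfl rfl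
      have rb := remove b hb a ha hab.symm (add_comm _ _) Finset.erase_right_comm
      apply mul_right_cancel₀ (mul_ne_zero hD hab')
      rw [zero_mul, Finset.sum_mul]
      trans (∑ i ∈ s, f (x i - x a) * (f (x i - (y a + y b - x a)) *
            ∏ l ∈ (s.erase a).erase b, f (x i - y l)) / ∏ l ∈ s.erase i, f (x i - x l)) *
            (f (y a - x b) * f (y b - x b) * (-1)) +
          (∑ i ∈ s, f (x i - x b) * (f (x i - (y a + y b - x b)) *
            ∏ l ∈ (s.erase a).erase b, f (x i - y l)) / ∏ l ∈ s.erase i, f (x i - x l)) *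
            (f (y a - x a) * f (y b - x a))
      · rw [Finset.sum_mul, Finset.sum_mul, ← Finset.sum_add_distrib]
        refine Finset.sum_congr rfl fun i _ => ?_
        rw [← Finset.mul_prod_erase s _ ha, ← Finset.mul_prod_erase (s.erase a) _ hbe]
        have := three_term_of_mul_eq_det h (x i) (y a) (y b) (x a) (x b)
        linear_combination ((∏ l ∈ (s.erase a).erase b, f (x i - y l)) /
          ∏ l ∈ s.erase i, f (x i - x l)) * this
      · rw [ra, rb]; ring
    rcases Nat.lt_or_ge m 2 with hm2 | hm2
    · have hs : s = {a, b} := by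
        symm
        apply Finset.eq_of_subset_of_card_le
        · intro c hc
          rcases Finset.mem_insert.1 hc with rfl | hc
          · exact ha
          · rwa [Finset.mem_singleton.1 hc]
        · rw [Finset.card_pair hab]; omega
      have e1 : ({a, b} : Finset ι).erase a = {b} := Finset.erase_insert (by simpa using hab)
      have e2 : ({a, b} : Finset ι).erase b = {a} := by
        rw [Finset.pair_comm]
        exact Finset.erase_insert (by simpa using hab.symm)
      rw [hs, Finset.sum_pair hab, Finset.sum_pair hab] at hxy
      rw [hs, Finset.sum_pair hab, Finset.prod_pair hab, Finset.prod_pair hab, e1, e2,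
        Finset.prod_singleton, Finset.prod_singleton,
        show x b - y a = -(x a - y b) by linear_combination hxy,
        show x b - y b = -(x a - y a) by linear_combination hxy,
        show x b - x a = -(x a - x b) by ring, odd, odd, odd]
      field_simp
      ring
    · obtain ⟨c, hc⟩ : ((s.erase a).erase b).Nonempty := by
        rw [← Finset.card_pos, Finset.card_erase_of_mem hbe, Finset.card_erase_of_mem ha]
        omega
      have hcb : c ≠ b := Finset.ne_of_mem_erase hc
      have hca : c ≠ a := Finset.ne_of_mem_erase (Finset.mem_of_mem_erase hc)
      have hcs : c ∈ s := Finset.mem_of_mem_erase (Finset.mem_of_mem_erase hc)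
      let Y : ℂ → ι → ℂ := fun r i => y i + r * ((if i = c then 1 else 0) - if i = a then 1 else 0)
      let S : ℂ → ℂ := fun r =>
        ∑ i ∈ s, (∏ l ∈ s, f (x i - Y r l)) / ∏ l ∈ s.erase i, f (x i - x l)
      have hfc : Continuous f := hd.continuous
      have hS : Continuous S := by
        refine continuous_finsetSum _ fun i _ => Continuous.div_const ?_ _
        refine continuous_finsetProd _ fun l _ => ?_
        fun_prop
      have hS0 : S 0 = ∑ i ∈ s, (∏ l ∈ s, f (x i - y l)) / ∏ l ∈ s.erase i, f (x i - x l) := by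
        simp [S, Y]
      have hev : ∀ᶠ r in nhdsWithin (0 : ℂ) {0}ᶜ, f (x a + x b - (y a + y b) + r) ≠ 0 := by
        have han : AnalyticOnNhd ℂ (fun r => f (x a + x b - (y a + y b) + r)) Set.univ := by
          apply DifferentiableOn.analyticOnNhd _ isOpen_univ
          apply Differentiable.differentiableOn
          fun_prop
        by_contra hcon
        have hz := han.eqOn_zero_of_preconnected_of_frequently_eq_zero isPreconnected_univ
          (Set.mem_univ 0) (by simpa only [Filter.Frequently] using hcon)
        apply hab'
        have := hz (Set.mem_univ (x a - x b - (x a + x b - (y a + y b))))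
        simpa only [add_sub_cancel, Pi.zero_apply] using this
      have hzero : ∀ᶠ r in nhdsWithin (0 : ℂ) {0}ᶜ, S r = 0 := by
        filter_upwards [hev] with r hr
        apply generic
        · simp [Y, Finset.sum_add_distrib, ← Finset.mul_sum, hcs, ha, hxy]
        · convert hr using 2
          simp [Y, hca.symm, hcb.symm, hab.symm]
          ring
      rw [← hS0]
      refine tendsto_nhds_unique (l := nhdsWithin (0 : ℂ) {0}ᶜ) (hS.continuousAt.tendsto.mono_left nhdsWithin_le_nhds) ?_
      exact tendsto_const_nhds.congr' (hzero.mono fun r hr => hr.symm)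

/-- The residue identity for the poles `u l`, `w` and the zeros `v l`, with the apparent pole at
`v j` made explicit. -/
theorem sum_residues_eq {n : ℕ} {f A B : ℂ → ℂ} (hd : Differentiable ℂ f)
    (h : ∀ x y, f (x + y) * f (x - y) = A x * B y - B x * A y) (u v : Fin n → ℂ) (γ w : ℂ)
    (j : Fin n) (huu : ∀ a b, a ≠ b → f (u a - u b) ≠ 0) (hvu : ∀ b, f (v j - u b) ≠ 0)
    (huw : ∀ b, f (u b - w) ≠ 0) :
    ∑ b, ((∏ l, f (u b - v l)) / ∏ l ∈ Finset.univ.filter (fun l => l ≠ b), f (u b - u l)) *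
        (f (v j - u b + (∑ l, (u l - v l) + γ)) / f (v j - u b)) *
        (f (u b - w + γ) / f (u b - w)) =
      f γ * f (v j - w + (∑ l, (u l - v l) + γ)) *
        (∏ l ∈ Finset.univ.filter (fun l => l ≠ j), f (w - v l)) / ∏ l, f (w - u l) := by
  have odd := odd_of_mul_eq_det h
  have hfilter : ∀ b : Fin n, Finset.univ.filter (fun l => l ≠ b) = Finset.univ.erase b := by
    intro b; ext; simp
  simp only [hfilter]
  set t := ∑ l, (u l - v l) + γ with ht
  let x : Option (Fin n) → ℂ := fun o => o.elim w u
  let y : Option (Fin n) → ℂ := fun o => o.elim (w - γ) (Function.update v j (v j + t))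
  have hsum : ∑ i, x i = ∑ i, y i := by
    simp only [Fintype.sum_option, x, y, Option.elim]
    rw [← Finset.add_sum_erase _ (Function.update v j (v j + t)) (Finset.mem_univ j),
      Function.update_self, Finset.sum_congr rfl (fun l hl =>
        Function.update_of_ne (Finset.ne_of_mem_erase hl) _ _), ht, Finset.sum_sub_distrib,
      ← Finset.add_sum_erase _ v (Finset.mem_univ j)]
    ring
  have hres := sum_prod_div_prod_erase_eq_zero hd h Finset.univ x y ?_ hsum
  · have hprod : ∀ z, ∏ l, f (z - Function.update v j (v j + t) l) =
        f (z - (v j + t)) * ∏ l ∈ Finset.univ.erase j, f (z - v l) := by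
      intro z
      rw [← Finset.mul_prod_erase _ _ (Finset.mem_univ j), Function.update_self]
      congr 1
      exact Finset.prod_congr rfl fun l hl => by
        rw [Function.update_of_ne (Finset.ne_of_mem_erase hl)]
    have hnone : ∏ l ∈ Finset.univ.erase (none : Option (Fin n)), f (w - x l) =
        ∏ l, f (w - u l) := by
      rw [show Finset.univ.erase (none : Option (Fin n)) = Finset.univ.map .some by
        ext i; cases i <;> simp, Finset.prod_map]
      rfl
    have hsome : ∀ b : Fin n, ∏ l ∈ Finset.univ.erase (some b), f (u b - x l) =
        f (u b - w) * ∏ l ∈ Finset.univ.erase b, f (u b - u l) := by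
      intro b
      rw [show Finset.univ.erase (some b) = insert none ((Finset.univ.erase b).map .some) by
        ext i; cases i <;> simp, Finset.prod_insert (by simp), Finset.prod_map]
      rfl
    rw [Fintype.sum_option] at hres
    simp only [Fintype.prod_option] at hres
    change f (w - (w - γ)) * (∏ l, f (w - Function.update v j (v j + t) l)) /
      (∏ l ∈ Finset.univ.erase none, f (w - x l)) +
      ∑ b, f (u b - (w - γ)) * (∏ l, f (u b - Function.update v j (v j + t) l)) /
        (∏ l ∈ Finset.univ.erase (some b), f (u b - x l)) = 0 at hres
    simp only [hprod, hnone, hsome] at hres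
    rw [show w - (w - γ) = γ by ring, show w - (v j + t) = -(v j - w + t) by ring, odd] at hres
    trans ∑ b, f (u b - (w - γ)) * (f (u b - (v j + t)) *
        ∏ l ∈ Finset.univ.erase j, f (u b - v l)) /
        (f (u b - w) * ∏ l ∈ Finset.univ.erase b, f (u b - u l))
    · refine Finset.sum_congr rfl fun b _ => ?_
      rw [← Finset.mul_prod_erase _ (fun l => f (u b - v l)) (Finset.mem_univ j),
        show u b - v j = -(v j - u b) by ring, odd,
        show u b - (v j + t) = -(v j - u b + t) by ring, odd,
        show u b - (w - γ) = u b - w + γ by ring]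
      have h1 := hvu b
      have h2 := huw b
      have h3 : ∏ l ∈ Finset.univ.erase b, f (u b - u l) ≠ 0 :=
        Finset.prod_ne_zero_iff.2 fun l hl => huu b l (Finset.ne_of_mem_erase hl).symm
      field_simp
    · linear_combination hres
  · rintro (_ | a) - (_ | b) - hab
    · exact absurd rfl hab
    · change f (w - u b) ≠ 0
      rw [← neg_sub, odd]
      exact neg_ne_zero.2 (huw b)
    · exact huw a
    · exact huu a b fun e => hab (congrArg some e)

end ThetaRelations

/-- Residue summation identity for elliptic functions, with `[u] = θ₁(ηu;τ)` and
`t = ∑ₗ(uₗ-vₗ)+γ`. -/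
theorem residue_summation_identity (n : ℕ) (τ η : ℂ) (hτ : 0 < τ.im) (hη : η ≠ 0)
    (u v : Fin n → ℂ) (γ : ℂ) (ε : ℤ) (hε : ε = 0 ∨ ε = 1 ∨ ε = -1)
    (j k : Fin n)
    (hu : Function.Injective u) (hv : Function.Injective v)
    (huu : ∀ a b, a ≠ b → jacobiTheta₁ (η * (u a - u b)) τ ≠ 0)
    (hvu : ∀ a b, jacobiTheta₁ (η * (v a - u b)) τ ≠ 0)
    (huvε : ∀ b, jacobiTheta₁ (η * (u b - v k + (ε : ℂ))) τ ≠ 0)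
    (hvvε : ε ≠ 0 → jacobiTheta₁ (η * (v j - v k + (ε : ℂ))) τ ≠ 0)
    (hvεu : ∀ l, jacobiTheta₁ (η * (v k - (ε : ℂ) - u l)) τ ≠ 0) :
    ∑ b, ((∏ l, jacobiTheta₁ (η * (u b - v l)) τ) /
          ∏ l ∈ Finset.univ.filter (fun l => l ≠ b), jacobiTheta₁ (η * (u b - u l)) τ) *
        (jacobiTheta₁ (η * (v j - u b + (∑ l, (u l - v l) + γ))) τ /
          jacobiTheta₁ (η * (v j - u b)) τ) *
        (jacobiTheta₁ (η * (u b - v k + γ + (ε : ℂ))) τ /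
          jacobiTheta₁ (η * (u b - v k + (ε : ℂ))) τ)
      = (if j = k ∧ ε = 0 then
            jacobiTheta₁ (η * γ) τ * jacobiTheta₁ (η * (∑ l, (u l - v l) + γ)) τ *
              (∏ l ∈ Finset.univ.filter (fun l => l ≠ j), jacobiTheta₁ (η * (v j - v l)) τ) /
              ∏ l, jacobiTheta₁ (η * (v j - u l)) τ
          else 0) -
        (if ε = 0 then 0
          else jacobiTheta₁ (η * γ) τ *
            (∏ l, jacobiTheta₁ (η * (v k - (ε : ℂ) - v l)) τ /
              jacobiTheta₁ (η * (v k - (ε : ℂ) - u l)) τ) *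
            (jacobiTheta₁ (η * (v j - v k + (ε : ℂ) + (∑ l, (u l - v l) + γ))) τ /
              jacobiTheta₁ (η * (v j - v k + (ε : ℂ))) τ)) := by
  have hd : Differentiable ℂ fun z => jacobiTheta₁ (η * z) τ :=
    (differentiable_jacobiTheta₁ hτ).comp (by fun_prop : Differentiable ℂ fun z : ℂ => η * z)
  have hdet : ∀ x y, jacobiTheta₁ (η * (x + y)) τ * jacobiTheta₁ (η * (x - y)) τ =
      jacobiTheta₂ (2 * (η * x)) (2 * τ) *
        (cexp (π * I * τ / 2 + 2 * π * I * (η * y)) * jacobiTheta₂ (2 * (η * y) + τ) (2 * τ)) -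
      cexp (π * I * τ / 2 + 2 * π * I * (η * x)) * jacobiTheta₂ (2 * (η * x) + τ) (2 * τ) *
        jacobiTheta₂ (2 * (η * y)) (2 * τ) := by
    intro x y
    rw [mul_add, mul_sub]
    exact jacobiTheta₁_add_mul_jacobiTheta₁_sub (η * x) (η * y) hτ
  obtain ⟨f, hf⟩ : ∃ f : ℂ → ℂ, ∀ z, jacobiTheta₁ (η * z) τ = f z := ⟨_, fun _ => rfl⟩
  simp only [hf] at *
  have odd := odd_of_mul_eq_det (A := fun x => jacobiTheta₂ (2 * (η * x)) (2 * τ)) hdet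
  have f0 : f 0 = 0 := by
    have := odd 0
    rw [neg_zero] at this
    linear_combination this / 2
  have key := sum_residues_eq (A := fun x => jacobiTheta₂ (2 * (η * x)) (2 * τ)) hd hdet u v γ
    (v k - ε) j huu (hvu j) (fun b => by rw [← sub_add]; exact huvε b)
  have e : ∀ b, u b - (v k - ε) + γ = u b - v k + γ + (ε : ℂ) := fun b => by ring
  simp only [e] at key
  simp only [← sub_add] at key
  rw [key]
  have hfilter : Finset.univ.filter (fun l => l ≠ j) = Finset.univ.erase j := by ext; simp
  by_cases hε0 : ε = 0
  · subst hε0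
    by_cases hjk : j = k
    · subst hjk
      simp
    · have : ∏ l ∈ Finset.univ.filter (fun l => l ≠ j), f (v k - v l) = 0 :=
        Finset.prod_eq_zero (i := k) (by simpa using Ne.symm hjk) (by rw [sub_self, f0])
      simp [hjk, this]
  · have hne := hvvε hε0
    rw [if_neg (fun h => hε0 h.2), if_neg hε0, Finset.prod_div_distrib, hfilter,
      ← Finset.mul_prod_erase _ (fun l => f (v k - ε - v l)) (Finset.mem_univ j),
      show v k - ε - v j = -(v j - v k + ε) by ring, odd]
    have hprod : ∏ l, f (v k - ε - u l) ≠ 0 := Finset.prod_ne_zero_iff.2 fun l _ => hvεu l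
    field_simp
    ring
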